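/- arXiv:1311.0557 — 3 statements merged into one kernel-verified Lean document; each statement's English description precedes it below -/
import Mathlib

section
/- Let L be an N×N matrix over ℂ((ε)) with block expansion L = [[A₀,0],[C₀,0]]·ε⁻¹ + [[A₁,B₁],[C₁,D₁]] + O(ε) (so ε·L ∈ A_𝔏, with A₀,C₀ the residue blocks and B₁,D₁ the constant-term right blocks). Then the coefficient of ε^j in det L vanishes for all j < −r, and the coefficient of ε^{−r} in det L equals det [[A₀,B₁],[C₀,D₁]]; in other words det L = ε^{−r}·det [[A₀,B₁],[C₀,D₁]] + O(ε^{−r+1}). -/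
open Matrix

noncomputable section

/-- The field `ℂ((ε))` of formal Laurent series over `ℂ`. -/
abbrev LS : Type := LaurentSeries ℂ

/-- Index type for `N × N` matrices in `2 × 2` block form, `N = r + s` with `s = N - r`. -/
abbrev Idx (r s : ℕ) : Type := Fin r ⊕ Fin s

/-- The complex matrix of coefficients of `ε^k` of a matrix of Laurent series. -/
def coeffM {r s : ℕ} (M : Matrix (Idx r s) (Idx r s) LS) (k : ℤ) :
    Matrix (Idx r s) (Idx r s) ℂ :=
  Matrix.of fun i j => (M i j).coeff k

/-- `M ∈ A`: every entry of `M` is a power series (no negative coefficients). -/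
def memA {r s : ℕ} (M : Matrix (Idx r s) (Idx r s) LS) : Prop :=
  ∀ i j, ∀ k : ℤ, k < 0 → (M i j).coeff k = 0

/-- `X ∈ 𝔎`: complex matrices whose first `r` rows vanish. -/
def memK {r s : ℕ} (X : Matrix (Idx r s) (Idx r s) ℂ) : Prop :=
  ∀ (i : Fin r) (j : Idx r s), X (Sum.inl i) j = 0

/-- `X ∈ 𝔏`: complex matrices whose last `N - r` columns vanish. -/
def memL {r s : ℕ} (X : Matrix (Idx r s) (Idx r s) ℂ) : Prop :=
  ∀ (i : Idx r s) (j : Fin s), X i (Sum.inr j) = 0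

/-- `M ∈ A_𝔎`: `M ∈ A` and `M|_{ε=0} ∈ 𝔎`. -/
def memAK {r s : ℕ} (M : Matrix (Idx r s) (Idx r s) LS) : Prop :=
  memA M ∧ memK (coeffM M 0)

/-- `M ∈ A_𝔏`: `M ∈ A` and `M|_{ε=0} ∈ 𝔏`. -/
def memAL {r s : ℕ} (M : Matrix (Idx r s) (Idx r s) LS) : Prop :=
  memA M ∧ memL (coeffM M 0)

/-- The Laurent series `ε`. -/
def eps : LS := HahnSeries.single (1 : ℤ) (1 : ℂ)

/-- A constant complex matrix viewed as a matrix of Laurent series. -/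
def constM {r s : ℕ} (X : Matrix (Idx r s) (Idx r s) ℂ) :
    Matrix (Idx r s) (Idx r s) LS :=
  X.map (algebraMap ℂ LS)

/-- The complex matrix `[[A₀,B₁],[C₀,D₁]]`: left `r` columns are the residues
(`ε⁻¹`-coefficients) and right `N−r` columns the constant terms of `L`. -/
def mixL {r s : ℕ} (L : Matrix (Idx r s) (Idx r s) LS) : Matrix (Idx r s) (Idx r s) ℂ :=
  Matrix.of fun i j =>
    match j with
    | Sum.inl j' => (L i (Sum.inl j')).coeff (-1)
    | Sum.inr j' => (L i (Sum.inr j')).coeff 0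

theorem coeff_mul_low (x y : LS) (a b : ℤ) (hx : ∀ k, k < a → x.coeff k = 0)
    (hy : ∀ k, k < b → y.coeff k = 0) :
    (∀ k, k < a + b → (x * y).coeff k = 0) ∧
      (x * y).coeff (a + b) = x.coeff a * y.coeff b := by
  have key : ∀ i j : ℤ, x.coeff i ≠ 0 → y.coeff j ≠ 0 → a ≤ i ∧ b ≤ j := by
    intro i j hi hj
    refine ⟨?_, ?_⟩
    · by_contra h
      exact hi (hx i (by omega))
    · by_contra h
      exact hj (hy j (by omega))
  refine ⟨?_, ?_⟩
  · intro k hk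
    rw [HahnSeries.coeff_mul]
    refine Finset.sum_eq_zero ?_
    rintro ⟨i, j⟩ hij
    rw [Finset.mem_addAntidiagonal] at hij
    obtain ⟨h1, h2, h3⟩ := hij
    have := key i j h1 h2
    simp only at h3
    omega
  · rw [HahnSeries.coeff_mul]
    refine Finset.sum_eq_single (a, b) ?_ ?_
    · rintro ⟨i, j⟩ hij hne
      rw [Finset.mem_addAntidiagonal] at hij
      obtain ⟨h1, h2, h3⟩ := hij
      have := key i j h1 h2
      simp only at h3
      exact absurd (Prod.ext (by simp only; omega) (by simp only; omega)) hne
    · intro h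
      rw [Finset.mem_addAntidiagonal] at h
      by_contra h0
      exact h ⟨left_ne_zero_of_mul h0, right_ne_zero_of_mul h0, rfl⟩

theorem coeff_prod_low {ι : Type*} (t : Finset ι) (f : ι → LS) (a : ι → ℤ)
    (hf : ∀ i, ∀ k, k < a i → (f i).coeff k = 0) :
    (∀ k, k < ∑ i ∈ t, a i → (∏ i ∈ t, f i).coeff k = 0) ∧
      (∏ i ∈ t, f i).coeff (∑ i ∈ t, a i) = ∏ i ∈ t, (f i).coeff (a i) := by
  classical
  induction t using Finset.induction_on with
  | empty =>
    refine ⟨fun k hk => ?_, ?_⟩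
    · simp only [Finset.sum_empty] at hk
      simp [HahnSeries.coeff_one, hk.ne]
    · simp [HahnSeries.coeff_one]
  | insert i t hi ih =>
    rw [Finset.prod_insert hi, Finset.sum_insert hi, Finset.prod_insert hi, ← ih.2]
    exact coeff_mul_low _ _ _ _ (hf i) ih.1

theorem coeff_eps_mul (x : LS) (k : ℤ) : (eps * x).coeff (k + 1) = x.coeff k := by
  have := HahnSeries.coeff_single_mul_add (r := (1 : ℂ)) (x := x) (a := k) (b := (1 : ℤ))
  simpa [eps] using this

/-- If `ε·L ∈ A_𝔏`, then the coefficient of `ε^j` in `det L` vanishes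
for `j < −r`, and the coefficient of `ε^{−r}` equals `det [[A₀,B₁],[C₀,D₁]]`. -/
theorem det_AL_pole_leading_coefficient (r s : ℕ) (hr : 0 < r) (hs : 0 < s)
    (L : Matrix (Idx r s) (Idx r s) LS) (hL : memAL (eps • L)) :
    (∀ j : ℤ, j < -(r : ℤ) → L.det.coeff j = 0) ∧
    L.det.coeff (-(r : ℤ)) = (mixL L).det := by
  let a : Idx r s → ℤ := fun j => Sum.elim (fun _ => -1) (fun _ => 0) j
  have hsum : ∑ j, a j = -(r : ℤ) := by simp [a]
  have hlow : ∀ i j, ∀ k, k < a j → (L i j).coeff k = 0 := by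
    intro i j k hk
    rw [← coeff_eps_mul]
    rcases j with j | j
    · simp only [a, Sum.elim_inl] at hk
      exact hL.1 i (Sum.inl j) (k + 1) (by omega)
    · simp only [a, Sum.elim_inr] at hk
      rcases (show k + 1 < 0 ∨ k + 1 = 0 by omega) with h | h
      · exact hL.1 i (Sum.inr j) (k + 1) h
      · rw [h]
        exact hL.2 i j
  have hmix : ∀ i j, mixL L i j = (L i j).coeff (a j) := by
    rintro i (j | j) <;> rfl
  have hp := fun σ : Equiv.Perm (Idx r s) =>
    coeff_prod_low Finset.univ (fun j => L (σ j) j) a (fun j => hlow (σ j) j)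
  simp only [hsum] at hp
  have hdet : ∀ k, L.det.coeff k = ∑ σ : Equiv.Perm (Idx r s),
      Equiv.Perm.sign σ • (∏ j, L (σ j) j).coeff k := by
    intro k
    rw [Matrix.det_apply, HahnSeries.coeff_sum]
    refine Finset.sum_congr rfl fun σ _ => ?_
    rcases Int.units_eq_one_or (Equiv.Perm.sign σ) with h | h <;> simp [h]
  refine ⟨fun k hk => ?_, ?_⟩
  · rw [hdet]
    exact Finset.sum_eq_zero fun σ _ => by rw [(hp σ).1 k hk, smul_zero]
  · rw [hdet, Matrix.det_apply]
    refine Finset.sum_congr rfl fun σ _ => ?_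
    rw [(hp σ).2]
    simp only [hmix]
end
end

section
/- Assume β_{m−1} ∈ A, β_m ∈ A_𝔎 with ord(det β_m) = r, and that the iterates defined by the dPI recursion satisfy ord(det β_{m+1}) = −r, ord(det β_{m+2}) = −r, ord(det β_{m+3}) = r, and ord(det β_{m+4}) = 0. Then the singularity is confined with confinement time 4: ε·β_{m+1} ∈ A_𝔏 and ε·β_{m+2} ∈ A_𝔏 (both iterates have at most a simple pole with residue in 𝔏), β_{m+3} ∈ A_𝔎, and β_{m+4} ∈ A with invertible constant term β_{m+4}|_{ε=0}. -/
open Matrix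

noncomputable section

theorem LS_order_mul {x y : LS} (hx : x ≠ 0) (hy : y ≠ 0) : (x * y).order = x.order + y.order :=
  HahnSeries.order_mul hx hy

/-- The subring of power series. -/
def SR : Subring LS where
  carrier := {x | 0 ≤ x.orderTop}
  mul_mem' {a b} ha hb := by
    have h := HahnSeries.orderTop_mul a b
    simp only [Set.mem_ofPred_eq] at *
    rw [h]; exact add_nonneg ha hb
  one_mem' := by simp
  add_mem' {a b} ha hb := by
    simp only [Set.mem_ofPred_eq] at *
    exact le_trans (le_min ha hb) HahnSeries.min_orderTop_le_orderTop_add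
  zero_mem' := by simp
  neg_mem' {a} ha := by
    simp only [Set.mem_ofPred_eq] at *
    rw [HahnSeries.orderTop_neg]; exact ha

theorem mem_SR_top {x : LS} : x ∈ SR ↔ 0 ≤ x.orderTop := by
  rw [← SetLike.mem_coe]
  exact Set.mem_ofPred_eq ▸ Iff.rfl

theorem mem_SR {x : LS} : x ∈ SR ↔ ∀ k : ℤ, k < 0 → x.coeff k = 0 := by
  rw [mem_SR_top, HahnSeries.le_orderTop_iff_forall]
  constructor
  · intro h k hk
    exact h k (by exact_mod_cast hk)
  · intro h k hk
    exact h k (by exact_mod_cast hk)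

theorem mem_SR_order {x : LS} : x ∈ SR ↔ 0 ≤ x.order :=
  mem_SR_top.trans HahnSeries.zero_le_orderTop_iff

theorem eps_ne : eps ≠ 0 := by simp [eps]

theorem eps_order : eps.order = 1 := HahnSeries.order_single one_ne_zero

theorem eps_coeff (x : LS) (k : ℤ) : (eps * x).coeff k = x.coeff (k - 1) := by
  simp [eps, HahnSeries.coeff_single_mul]

theorem eps_inv_coeff (x : LS) (k : ℤ) : (eps⁻¹ * x).coeff k = x.coeff (k + 1) := by
  have := eps_coeff (eps⁻¹ * x) (k + 1)
  rw [mul_inv_cancel_left₀ eps_ne] at this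
  rw [this]; simp

theorem algMap_coeff (c : ℂ) (k : ℤ) :
    ((algebraMap ℂ LS) c).coeff k = if k = 0 then c else 0 := by
  have : algebraMap ℂ LS c = HahnSeries.single (0 : ℤ) c := by
    rw [LaurentSeries.algebraMap_apply]; rfl
  rw [this, HahnSeries.coeff_single]
  congr

theorem coeff_zero_mul {x y : LS} (hx : x ∈ SR) (hy : y ∈ SR) :
    (x * y).coeff 0 = x.coeff 0 * y.coeff 0 := by
  set x' : LS := eps⁻¹ * (x - algebraMap ℂ LS (x.coeff 0)) with hx'
  have h1 : x = algebraMap ℂ LS (x.coeff 0) + eps * x' := by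
    rw [hx', mul_inv_cancel_left₀ eps_ne]; ring
  have h2 : x' ∈ SR := by
    rw [mem_SR]
    intro k hk
    rw [hx', eps_inv_coeff, HahnSeries.coeff_sub, algMap_coeff]
    split_ifs with h
    · rw [h]; simp
    · rw [mem_SR.1 hx _ (by omega)]; simp
  conv_lhs => rw [h1]
  rw [add_mul, HahnSeries.coeff_add, mul_assoc, eps_coeff,
    mem_SR.1 (SR.mul_mem h2 hy) _ (by norm_num), add_zero]
  have : algebraMap ℂ LS (x.coeff 0) = HahnSeries.single (0 : ℤ) (x.coeff 0) := by
    rw [LaurentSeries.algebraMap_apply]; rfl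
  rw [this, HahnSeries.coeff_single_mul]
  simp

section mats
variable {r s : ℕ}

/-- The ring `A`. -/
def AR (r s : ℕ) : Subring (Matrix (Idx r s) (Idx r s) LS) := SR.matrix

theorem mem_AR {M : Matrix (Idx r s) (Idx r s) LS} : M ∈ AR r s ↔ ∀ i j, M i j ∈ SR := Iff.rfl

theorem mem_AR_iff {M : Matrix (Idx r s) (Idx r s) LS} : M ∈ AR r s ↔ memA M := by
  simp only [mem_AR, mem_SR, memA]

theorem smul_AR {M : Matrix (Idx r s) (Idx r s) LS} {c : LS} (hc : c ∈ SR) (hM : M ∈ AR r s) :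
    c • M ∈ AR r s := fun i j => SR.mul_mem hc (hM i j)

theorem const_AR (α : Matrix (Idx r s) (Idx r s) ℂ) : constM α ∈ AR r s := by
  rw [mem_AR_iff]
  intro i j k hk
  simp [constM, algMap_coeff, hk.ne]

theorem smul_mulM (c : LS) (M P : Matrix (Idx r s) (Idx r s) LS) :
    (c • M) * P = c • (M * P) := by exact Matrix.smul_mul c M P

theorem mul_smulM (c : LS) (M P : Matrix (Idx r s) (Idx r s) LS) :
    M * (c • P) = c • (M * P) := by exact Matrix.mul_smul M c P

/-- Unit condition. -/
def UU (M : Matrix (Idx r s) (Idx r s) LS) : Prop := M ∈ AR r s ∧ M.det ≠ 0 ∧ M.det.order = 0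

theorem UU.inv {M : Matrix (Idx r s) (Idx r s) LS} (h : UU M) : M⁻¹ ∈ AR r s := by
  obtain ⟨hM, h0, h1⟩ := h
  have hd : (M.det)⁻¹ ∈ SR := by
    rw [mem_SR_order]
    have := LS_order_mul h0 (inv_ne_zero h0)
    rw [mul_inv_cancel₀ h0, HahnSeries.order_one, h1] at this
    omega
  rw [Matrix.inv_def, Ring.inverse_eq_inv']
  apply smul_AR hd
  let M' : Matrix (Idx r s) (Idx r s) SR := Matrix.of fun i j => ⟨M i j, hM i j⟩
  have : M = SR.subtype.mapMatrix M' := by ext i j; rfl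
  rw [this, ← RingHom.map_adjugate]
  intro i j
  exact (M'.adjugate i j).2

/-- `diag(ε, 1)`. -/
def DD (r s : ℕ) : Matrix (Idx r s) (Idx r s) LS :=
  Matrix.diagonal (Sum.elim (fun _ => eps) (fun _ => 1))

/-- `diag(ε⁻¹, 1)`. -/
def DI (r s : ℕ) : Matrix (Idx r s) (Idx r s) LS :=
  Matrix.diagonal (Sum.elim (fun _ => eps⁻¹) (fun _ => 1))

theorem DD_DI : DD r s * DI r s = 1 := by
  rw [DD, DI, Matrix.diagonal_mul_diagonal, ← Matrix.diagonal_one]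
  congr 1
  ext i
  rcases i with i | i <;> simp [eps_ne]

theorem DI_DD : DI r s * DD r s = 1 := by
  rw [DD, DI, Matrix.diagonal_mul_diagonal, ← Matrix.diagonal_one]
  congr 1
  ext i
  rcases i with i | i <;> simp [eps_ne]

theorem DD_det : (DD r s).det = eps ^ r := by
  simp [DD, Matrix.det_diagonal]

theorem DD_AR : DD r s ∈ AR r s := by
  apply (Matrix.diagonal_mem_matrix_iff (S := (SR : Set LS)) SR.zero_mem).2
  rintro (i | i)
  · change eps ∈ SR
    rw [mem_SR_order, eps_order]; norm_num
  · exact SR.one_mem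

theorem eps_pow_order (n : ℕ) : (eps ^ n).order = n := by
  induction n with
  | zero => simp
  | succ n ih => rw [pow_succ, LS_order_mul (pow_ne_zero _ eps_ne) eps_ne, ih, eps_order]; simp

theorem memAL_iff {M : Matrix (Idx r s) (Idx r s) LS} :
    memAL (eps • M) ↔ M * DD r s ∈ AR r s := by
  rw [mem_AR_iff]
  unfold memAL memA memL coeffM DD
  simp only [Matrix.smul_apply, smul_eq_mul, Matrix.mul_diagonal, Matrix.of_apply, eps_coeff]
  constructor
  · rintro ⟨h1, h2⟩ i (j | j) k hk
    · simp only [Sum.elim_inl]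
      rw [mul_comm, eps_coeff]; exact h1 _ _ _ hk
    · simp only [Sum.elim_inr, mul_one]
      rcases eq_or_ne k (-1) with rfl | h
      · exact h2 i j
      · have := h1 i (Sum.inr j) (k + 1) (by omega)
        simpa using this
  · intro h
    refine ⟨?_, ?_⟩
    · rintro i (j | j) k hk
      · have := h i (Sum.inl j) k hk
        simp only [Sum.elim_inl] at this
        rwa [mul_comm, eps_coeff] at this
      · have := h i (Sum.inr j) (k - 1) (by omega)
        simpa using this
    · intro i j
      have := h i (Sum.inr j) (0 - 1) (by omega)
      simpa using this

theorem memAK_iff {M : Matrix (Idx r s) (Idx r s) LS} :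
    memAK M ↔ DI r s * M ∈ AR r s := by
  rw [mem_AR_iff]
  unfold memAK memA memK coeffM DI
  simp only [Matrix.diagonal_mul, Matrix.of_apply]
  constructor
  · rintro ⟨h1, h2⟩ (i | i) j k hk
    · simp only [Sum.elim_inl, eps_inv_coeff]
      rcases eq_or_ne k (-1) with rfl | h
      · exact h2 i j
      · exact h1 _ _ _ (by omega)
    · simp only [Sum.elim_inr, one_mul]
      exact h1 _ _ _ hk
  · intro h
    refine ⟨?_, ?_⟩
    · rintro (i | i) j k hk
      · have := h (Sum.inl i) j (k - 1) (by omega)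
        simpa [eps_inv_coeff] using this
      · have := h (Sum.inr i) j k hk
        simpa using this
    · intro i j
      have := h (Sum.inl i) j (-1) (by omega)
      simpa [eps_inv_coeff] using this

theorem UU_right {M : Matrix (Idx r s) (Idx r s) LS} (h : M * DD r s ∈ AR r s)
    (h0 : M.det ≠ 0 ∧ M.det.order = -(r : ℤ)) : UU (M * DD r s) := by
  refine ⟨h, ?_, ?_⟩
  · rw [Matrix.det_mul, DD_det]; exact mul_ne_zero h0.1 (pow_ne_zero _ eps_ne)
  · rw [Matrix.det_mul, DD_det, LS_order_mul h0.1 (pow_ne_zero _ eps_ne), eps_pow_order, h0.2]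
    simp

theorem UU_left {M : Matrix (Idx r s) (Idx r s) LS} (h : DI r s * M ∈ AR r s)
    (h0 : M.det ≠ 0 ∧ M.det.order = (r : ℤ)) : UU (DI r s * M) := by
  have e1 : M.det = (DD r s).det * (DI r s * M).det := by
    rw [← Matrix.det_mul, ← Matrix.mul_assoc, DD_DI, Matrix.one_mul]
  have hne : (DI r s * M).det ≠ 0 := by
    intro h; rw [h, mul_zero] at e1; exact h0.1 e1
  refine ⟨h, hne, ?_⟩
  have := congrArg HahnSeries.order e1
  rw [DD_det, LS_order_mul (pow_ne_zero _ eps_ne) hne, eps_pow_order, h0.2] at this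
  omega

theorem DD_inv : (DD r s)⁻¹ = DI r s := Matrix.inv_eq_right_inv DD_DI
theorem DI_inv : (DI r s)⁻¹ = DD r s := Matrix.inv_eq_right_inv DI_DD

theorem unit_coeff {M : Matrix (Idx r s) (Idx r s) LS} (h : UU M) : IsUnit (coeffM M 0) := by
  have h1 : M * M⁻¹ = 1 := Matrix.mul_nonsing_inv _ (isUnit_iff_ne_zero.2 h.2.1)
  have h2 : coeffM M 0 * coeffM M⁻¹ 0 = 1 := by
    ext i j
    have := congrFun (congrFun h1 i) j
    rw [Matrix.mul_apply] at this
    have := congrArg (fun x : LS => x.coeff 0) this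
    simp only [HahnSeries.coeff_sum] at this
    rw [Matrix.mul_apply]
    simp only [coeffM, Matrix.of_apply]
    rw [← Finset.sum_congr rfl (fun k _ => coeff_zero_mul (h.1 i k) (h.inv k j)), this]
    by_cases hij : i = j
    · subst hij; simp
    · simp [hij]
  exact (Matrix.isUnit_iff_isUnit_det _).2 (Matrix.isUnit_det_of_right_inverse h2)

end mats

theorem alg_key {K R : Type*} [Field K] [Ring R] [Algebra K R] (k : K)
    (b b' c c' d d' e e' a g : R) (hb' : b * b' = 1) (hb : b' * b = 1)
    (hc' : c' * c = 1) (hd' : d' * d = 1) (he' : e' * e = 1)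
    (hc : c = k • b' - a) (hd : d = g - k • b')
    (he : e = (k + 2) • d' - (k + 1) • c' + b) :
    (k + 3) • e' + k • b' = (e' * b) * ((k + 2) • (b' * d' * g) - (k + 1) • (b' * c' * a)) := by
  have h1 : k • c' = b + c' * a * b := by
    have h : c' * (k • b' - a) * b = b := by rw [← hc, hc', one_mul]
    have h2 : c' * (k • b' - a) * b = k • c' - c' * a * b := by
      rw [mul_sub, sub_mul, mul_smul_comm, smul_mul_assoc, mul_assoc, hb, mul_one]
    rw [h2] at h
    exact sub_eq_iff_eq_add.1 h
  have h2 : k • d' = d' * g * b - b := by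
    have h : d' * (g - k • b') * b = b := by rw [← hd, hd', one_mul]
    have h2 : d' * (g - k • b') * b = d' * g * b - k • d' := by
      rw [mul_sub, sub_mul, mul_smul_comm, smul_mul_assoc, mul_assoc d' b', hb, mul_one]
    rw [h2] at h
    rw [sub_eq_iff_eq_add.1 h]; abel
  have h3 : k • e + (k + 3) • b = ((k + 2) • (d' * g) - (k + 1) • (c' * a)) * b := by
    have : k • e = (k + 2) • (k • d') - (k + 1) • (k • c') + k • b := by rw [he]; module
    rw [this, h1, h2, sub_mul, smul_mul_assoc, smul_mul_assoc]
    module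
  have h4 : (k + 3) • e' + k • b' = e' * (k • e + (k + 3) • b) * b' := by
    rw [mul_add, add_mul, mul_smul_comm, he', mul_smul_comm, smul_mul_assoc, smul_mul_assoc,
      mul_assoc, hb', one_mul, mul_one]
    abel
  rw [h4, h3, mul_assoc, mul_assoc _ b, hb', mul_one, mul_assoc e' b, mul_sub b, mul_smul_comm,
    mul_smul_comm, ← mul_assoc b, ← mul_assoc b, ← mul_assoc b, ← mul_assoc b, hb', one_mul, one_mul]

/-- Theorem 1 of the paper, singularity confinement with confinement
time 4. Assume `β_{m−1} ∈ A`, `β_m ∈ A_𝔎` with `ord(det β_m) = r`, and that the dPI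
iterates `β_{n+1} = n·β_n⁻¹ − β_{n−1} − β_n − α` satisfy `ord(det β_{m+1}) = −r`,
`ord(det β_{m+2}) = −r`, `ord(det β_{m+3}) = r` and `ord(det β_{m+4}) = 0`. Then
`ε·β_{m+1}, ε·β_{m+2} ∈ A_𝔏`, `β_{m+3} ∈ A_𝔎`, and `β_{m+4} ∈ A` with invertible
constant term. -/
theorem singularity_confinement (r s m : ℕ) (hr : 0 < r) (hs : 0 < s) (hm : 2 ≤ m)
    (α : Matrix (Idx r s) (Idx r s) ℂ)
    (β : ℕ → Matrix (Idx r s) (Idx r s) LS)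
    (hrec : ∀ n : ℕ, m ≤ n → n ≤ m + 3 →
      β (n + 1) = (n : LS) • (β n)⁻¹ - β (n - 1) - β n - constM α)
    (hprev : memA (β (m - 1)))
    (hβm : memAK (β m))
    (hdm : (β m).det ≠ 0 ∧ (β m).det.order = (r : ℤ))
    (hd1 : (β (m + 1)).det ≠ 0 ∧ (β (m + 1)).det.order = -(r : ℤ))
    (hd2 : (β (m + 2)).det ≠ 0 ∧ (β (m + 2)).det.order = -(r : ℤ))
    (hd3 : (β (m + 3)).det ≠ 0 ∧ (β (m + 3)).det.order = (r : ℤ))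
    (hd4 : (β (m + 4)).det ≠ 0 ∧ (β (m + 4)).det.order = 0) :
    memAL (eps • β (m + 1)) ∧
    memAL (eps • β (m + 2)) ∧
    memAK (β (m + 3)) ∧
    (memA (β (m + 4)) ∧ IsUnit (coeffM (β (m + 4)) 0)) := by
  have r0 := hrec m le_rfl (by omega)
  have r1 := hrec (m + 1) (by omega) (by omega)
  have r2 := hrec (m + 2) (by omega) (by omega)
  have r3 := hrec (m + 3) (by omega) (by omega)
  have e1 : m + 1 - 1 = m := by omega
  have e2 : m + 2 - 1 = m + 1 := by omega
  have e3 : m + 3 - 1 = m + 2 := by omega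
  rw [e1] at r1
  rw [e2] at r2
  rw [e3] at r3
  rw [memAK_iff] at hβm
  rw [memAL_iff, memAL_iff, memAK_iff, ← mem_AR_iff]
  rw [← mem_AR_iff] at hprev
  change β (m + 2) = _ at r1
  change β (m + 3) = _ at r2
  change β (m + 4) = _ at r3
  push_cast at r1 r2 r3
  generalize β (m - 1) = z at *
  generalize β m = b at *
  generalize β (m + 1) = c at *
  generalize β (m + 2) = d at *
  generalize β (m + 3) = e at *
  generalize β (m + 4) = f at *
  have hnat : ∀ n : ℕ, (n : LS) ∈ SR := fun n => natCast_mem SR n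
  have hk := hnat m
  have hk1 : (m : LS) + 1 ∈ SR := by exact_mod_cast hnat (m + 1)
  have hk2 : (m : LS) + 2 ∈ SR := by exact_mod_cast hnat (m + 2)
  generalize (m : LS) = k at *
  have hα := const_AR α
  generalize constM α = α' at *
  have ub : IsUnit b.det := isUnit_iff_ne_zero.2 hdm.1
  have uc : IsUnit c.det := isUnit_iff_ne_zero.2 hd1.1
  have ud : IsUnit d.det := isUnit_iff_ne_zero.2 hd2.1
  have ue : IsUnit e.det := isUnit_iff_ne_zero.2 hd3.1
  have hD := DD_AR (r := r) (s := s)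
  have cancel1 : ∀ X : Matrix (Idx r s) (Idx r s) LS, DD r s * (DI r s * X) = X := fun X => by
    rw [← mul_assoc, DD_DI, one_mul]
  have cancel2 : ∀ X : Matrix (Idx r s) (Idx r s) LS, DI r s * (DD r s * X) = X := fun X => by
    rw [← mul_assoc, DI_DD, one_mul]
  have Ub := UU_left hβm hdm
  have hb : b ∈ AR r s := by
    rw [← cancel1 b]; exact mul_mem hD hβm
  -- b⁻¹ * D in A
  have hbD : b⁻¹ * DD r s ∈ AR r s := by
    have := Ub.inv
    rwa [Matrix.mul_inv_rev, DI_inv] at this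
  have hcD : c * DD r s ∈ AR r s := by
    rw [r0, sub_mul, sub_mul, sub_mul, smul_mulM]
    exact sub_mem (sub_mem (sub_mem (smul_AR hk hbD) (mul_mem hprev hD)) (mul_mem hb hD))
      (mul_mem hα hD)
  have Uc := UU_right hcD hd1
  have hc' : DI r s * c⁻¹ ∈ AR r s := by
    have := Uc.inv
    rwa [Matrix.mul_inv_rev, DD_inv] at this
  have hci : c⁻¹ ∈ AR r s := by
    rw [← cancel1 c⁻¹]; exact mul_mem hD hc'
  have hdD : d * DD r s ∈ AR r s := by
    rw [r1, sub_mul, sub_mul, sub_mul, smul_mulM]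
    exact sub_mem (sub_mem (sub_mem (smul_AR hk1 (mul_mem hci hD)) (mul_mem hb hD)) hcD)
      (mul_mem hα hD)
  have Ud := UU_right hdD hd2
  have hd' : DI r s * d⁻¹ ∈ AR r s := by
    have := Ud.inv
    rwa [Matrix.mul_inv_rev, DD_inv] at this
  have he0 : e = (k + 2) • d⁻¹ - (k + 1) • c⁻¹ + b := by
    have h1 : (k + 1) • c⁻¹ = c + d + α' + b := by rw [r1]; abel
    rw [r2, h1]; abel
  have heK : DI r s * e ∈ AR r s := by
    rw [he0, mul_add, mul_sub, mul_smulM, mul_smulM]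
    exact add_mem (sub_mem (smul_AR hk2 hd') (smul_AR hk1 hc')) hβm
  have Ue := UU_left heK hd3
  have he : e ∈ AR r s := by
    rw [← cancel1 e]; exact mul_mem hD heK
  have heb : e⁻¹ * b ∈ AR r s := by
    have := mul_mem Ue.inv hβm
    rwa [Matrix.mul_inv_rev, DI_inv, mul_assoc, cancel1] at this
  have hbc : b⁻¹ * c⁻¹ ∈ AR r s := by
    have := mul_mem hbD hc'
    rwa [mul_assoc, cancel1] at this
  have hbd : b⁻¹ * d⁻¹ ∈ AR r s := by
    have := mul_mem hbD hd'
    rwa [mul_assoc, cancel1] at this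
  have hg : z + (k + 1) • c⁻¹ ∈ AR r s := add_mem hprev (smul_AR hk1 hci)
  have ha : z + b + α' ∈ AR r s := add_mem (add_mem hprev hb) hα
  have hdg : d = (z + (k + 1) • c⁻¹) - k • b⁻¹ := by
    have hz : z = k • b⁻¹ - b - α' - c := by rw [r0]; abel
    rw [r1, hz]; abel
  have key := alg_key k b b⁻¹ c c⁻¹ d d⁻¹ e e⁻¹ (z + b + α') (z + (k + 1) • c⁻¹)
    (Matrix.mul_nonsing_inv _ ub) (Matrix.nonsing_inv_mul _ ub)
    (Matrix.nonsing_inv_mul _ uc) (Matrix.nonsing_inv_mul _ ud) (Matrix.nonsing_inv_mul _ ue)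
    (by rw [r0]; abel) hdg he0
  have hf : f ∈ AR r s := by
    have : f = ((k + 3) • e⁻¹ + k • b⁻¹) - (z + (k + 1) • c⁻¹) - e - α' := by
      rw [r3, hdg]; abel
    rw [this, key]
    exact sub_mem (sub_mem (sub_mem (mul_mem heb (sub_mem (smul_AR hk2 (mul_mem hbd hg))
      (smul_AR hk1 (mul_mem hbc ha)))) hg) he) hα
  exact ⟨hcD, hdD, heK, hf, unit_coeff ⟨hf, hd4⟩⟩
end
end

section
/- Assume β_{m−1} ∈ A, β_m ∈ A_𝔎 with ord(det β_m) = r, det D_{m,0} ≠ 0, and det Z1 ≠ 0, and define the dPI iterates β_{m+1}, β_{m+2}. Then the coefficient of ε^j in det β_{m+2} vanishes for all j < −r, and the coefficient of ε^{−r} equals det [[ −m·S1⁻¹ , m·S1⁻¹·B_{m,1}·D_{m,0}⁻¹ + B_{m−1,0} ], [ m·D_{m,0}⁻¹·C_{m,0}·S1⁻¹ , (m+1)·Z1⁻¹ − m·D_{m,0}⁻¹ − m·D_{m,0}⁻¹·C_{m,0}·S1⁻¹·B_{m,1}·D_{m,0}⁻¹ + D_{m−1,0} ]]; i.e., det β_{m+2}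 = ε^{−r}·(this determinant) + O(ε^{−r+1}). -/
open Matrix

noncomputable section

/-- `D_{M,k}` : the `(2,2)` block (size `(N−r) × (N−r)`) of the `ε^k`-coefficient. -/
def Dblk {r s : ℕ} (M : Matrix (Idx r s) (Idx r s) LS) (k : ℤ) : Matrix (Fin s) (Fin s) ℂ :=
  (coeffM M k).toBlocks₂₂

/-- `C_{M,k}` : the `(2,1)` block (size `(N−r) × r`) of the `ε^k`-coefficient. -/
def Cblk {r s : ℕ} (M : Matrix (Idx r s) (Idx r s) LS) (k : ℤ) : Matrix (Fin s) (Fin r) ℂ :=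
  (coeffM M k).toBlocks₂₁

/-- `B_{M,k}` : the `(1,2)` block (size `r × (N−r)`) of the `ε^k`-coefficient. -/
def Bblk {r s : ℕ} (M : Matrix (Idx r s) (Idx r s) LS) (k : ℤ) : Matrix (Fin r) (Fin s) ℂ :=
  (coeffM M k).toBlocks₁₂

/-- `A_{M,k}` : the `(1,1)` block (size `r × r`) of the `ε^k`-coefficient. -/
def Ablk {r s : ℕ} (M : Matrix (Idx r s) (Idx r s) LS) (k : ℤ) : Matrix (Fin r) (Fin r) ℂ :=
  (coeffM M k).toBlocks₁₁

/-- The leading Schur complement `S₁ = A_{m,1} − B_{m,1}·D_{m,0}⁻¹·C_{m,0}` of `β_m`. -/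
def S1 {r s : ℕ} (βm : Matrix (Idx r s) (Idx r s) LS) : Matrix (Fin r) (Fin r) ℂ :=
  Ablk βm 1 - Bblk βm 1 * (Dblk βm 0)⁻¹ * Cblk βm 0

/-- `Z₁ := m·D_{m,0}⁻¹ − D_{m−1,0} − D_{m,0} − α₂₂ − D_{m,0}⁻¹·C_{m,0}·(B_{m−1,0} + α₁₂)`. -/
def Z1 {r s : ℕ} (m : ℕ) (βprev βm : Matrix (Idx r s) (Idx r s) LS)
    (α : Matrix (Idx r s) (Idx r s) ℂ) : Matrix (Fin s) (Fin s) ℂ :=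
  (m : ℂ) • (Dblk βm 0)⁻¹ - Dblk βprev 0 - Dblk βm 0 - α.toBlocks₂₂
    - (Dblk βm 0)⁻¹ * Cblk βm 0 * (Bblk βprev 0 + α.toBlocks₁₂)

/-- `Z₂ := (m+1)·Z₁⁻¹ + D_{m,0}⁻¹·C_{m,0}·B_{m−1,0} − m·D_{m,0}⁻¹ + D_{m−1,0}`. -/
def Z2 {r s : ℕ} (m : ℕ) (βprev βm : Matrix (Idx r s) (Idx r s) LS)
    (α : Matrix (Idx r s) (Idx r s) ℂ) : Matrix (Fin s) (Fin s) ℂ :=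
  ((m : ℂ) + 1) • (Z1 m βprev βm α)⁻¹ + (Dblk βm 0)⁻¹ * Cblk βm 0 * Bblk βprev 0
    - (m : ℂ) • (Dblk βm 0)⁻¹ + Dblk βprev 0

/-- `Z₃ := D_{m,0} − (m+1)·Z₁⁻¹ + (m+2)·Z₂⁻¹`. -/
def Z3 {r s : ℕ} (m : ℕ) (βprev βm : Matrix (Idx r s) (Idx r s) LS)
    (α : Matrix (Idx r s) (Idx r s) ℂ) : Matrix (Fin s) (Fin s) ℂ :=
  Dblk βm 0 - ((m : ℂ) + 1) • (Z1 m βprev βm α)⁻¹ + ((m : ℂ) + 2) • (Z2 m βprev βm α)⁻¹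

/-- Power series to Laurent series. -/
def phi : PowerSeries ℂ →+* LS := HahnSeries.ofPowerSeries ℤ ℂ

theorem phi_coeff (f : PowerSeries ℂ) (i : ℤ) :
    (phi f).coeff i = if i < 0 then 0 else PowerSeries.coeff i.natAbs f :=
  PowerSeries.coeff_coe f i

theorem phi_coeff_nat (f : PowerSeries ℂ) (i : ℕ) :
    (phi f).coeff (i : ℤ) = PowerSeries.coeff i f := by
  rw [phi_coeff]; simp

theorem phi_X : phi PowerSeries.X = HahnSeries.single (1 : ℤ) (1 : ℂ) :=
  HahnSeries.ofPowerSeries_X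

theorem phi_X_pow (n : ℕ) : phi (PowerSeries.X ^ n) = HahnSeries.single (n : ℤ) (1 : ℂ) :=
  HahnSeries.ofPowerSeries_X_pow n

theorem phi_C (a : ℂ) : phi (PowerSeries.C a) = algebraMap ℂ LS a := by
  rw [HahnSeries.algebraMap_apply']; rfl

/-- matrix version of phi -/
abbrev Phi {r s : ℕ} : Matrix (Idx r s) (Idx r s) (PowerSeries ℂ) →+*
    Matrix (Idx r s) (Idx r s) LS := phi.mapMatrix

/-- constant coefficient -/
abbrev Kap {r s : ℕ} : Matrix (Idx r s) (Idx r s) (PowerSeries ℂ) →+*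
    Matrix (Idx r s) (Idx r s) ℂ := (PowerSeries.constantCoeff (R := ℂ)).mapMatrix

/-- diag(X, 1) -/
def EE (r s : ℕ) : Matrix (Idx r s) (Idx r s) (PowerSeries ℂ) :=
  Matrix.diagonal (Sum.elim (fun _ => PowerSeries.X) (fun _ => 1))

theorem det_EE (r s : ℕ) : (EE r s).det = PowerSeries.X ^ r := by
  simp [EE, Matrix.det_diagonal, Fintype.prod_sum_type]

theorem kap_EE (r s : ℕ) : Kap (EE r s) = fromBlocks 0 0 0 1 := by
  ext i j
  rcases i with i | i <;> rcases j with j | j <;>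
    simp [EE, Matrix.diagonal_apply, Matrix.one_apply] <;> split_ifs <;> simp

theorem lift_memA {r s : ℕ} (M : Matrix (Idx r s) (Idx r s) LS) (h : memA M) :
    ∃ M' : Matrix (Idx r s) (Idx r s) (PowerSeries ℂ), M = Phi M' ∧ Kap M' = coeffM M 0 := by
  refine ⟨Matrix.of fun i j => PowerSeries.mk fun n => (M i j).coeff (n : ℤ), ?_, ?_⟩
  · ext i j k
    simp only [Phi, RingHom.mapMatrix_apply, Matrix.map_apply, phi_coeff, Matrix.of_apply,
      PowerSeries.coeff_mk]
    split_ifs with hk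
    · exact h i j k hk
    · congr 1; omega
  · ext i j
    simp [coeffM]

theorem lift_memAK {r s : ℕ} (M : Matrix (Idx r s) (Idx r s) LS) (h : memAK M) :
    ∃ P : Matrix (Idx r s) (Idx r s) (PowerSeries ℂ), M = Phi (EE r s * P) ∧
      Kap P = fromBlocks (Ablk M 1) (Bblk M 1) (Cblk M 0) (Dblk M 0) := by
  refine ⟨Matrix.of fun i j => PowerSeries.mk fun n =>
    (M i j).coeff ((n : ℤ) + Sum.elim (fun _ => 1) (fun _ => 0) i), ?_, ?_⟩
  · ext i j k
    simp only [Phi, RingHom.mapMatrix_apply, Matrix.map_apply, EE, Matrix.diagonal_mul]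
    rcases i with i | i
    · simp only [Sum.elim_inl, map_mul, phi_X, Matrix.of_apply]
      rw [HahnSeries.coeff_single_mul, one_mul, phi_coeff]
      split_ifs with hk
      · rcases (show k < 0 ∨ k = 0 by omega) with hk | rfl
        · exact h.1 _ _ _ hk
        · exact h.2 i j
      · rw [PowerSeries.coeff_mk]; congr 1; omega
    · simp only [Sum.elim_inr, one_mul, Matrix.of_apply, phi_coeff]
      split_ifs with hk
      · exact h.1 _ _ _ hk
      · rw [PowerSeries.coeff_mk]; congr 1; omega
  · ext i j
    rcases i with i | i <;> rcases j with j | j <;>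
      simp [Ablk, Bblk, Cblk, Dblk, coeffM, Matrix.toBlocks₁₁, Matrix.toBlocks₁₂,
        Matrix.toBlocks₂₁, Matrix.toBlocks₂₂]

theorem exists_inv {r s : ℕ} (P : Matrix (Idx r s) (Idx r s) (PowerSeries ℂ))
    (h : (Kap P).det ≠ 0) : ∃ V, P * V = 1 ∧ V * P = 1 := by
  have : IsUnit P.det := by
    rw [PowerSeries.isUnit_iff_constantCoeff, RingHom.map_det]
    exact isUnit_iff_ne_zero.mpr h
  exact ⟨P⁻¹, Matrix.mul_nonsing_inv _ this, Matrix.nonsing_inv_mul _ this⟩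

theorem block_inv {r s : ℕ} (A : Matrix (Fin r) (Fin r) ℂ) (B : Matrix (Fin r) (Fin s) ℂ)
    (C : Matrix (Fin s) (Fin r) ℂ) (D : Matrix (Fin s) (Fin s) ℂ) (S : Matrix (Fin r) (Fin r) ℂ)
    (hS : S = A - B * D⁻¹ * C) (hD : D.det ≠ 0) (hP : (fromBlocks A B C D).det ≠ 0)
    (V : Matrix (Idx r s) (Idx r s) ℂ) (hV : fromBlocks A B C D * V = 1) :
    S.det ≠ 0 ∧ V = fromBlocks S⁻¹ (-(S⁻¹ * B * D⁻¹)) (-(D⁻¹ * C * S⁻¹))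
      (D⁻¹ + D⁻¹ * C * S⁻¹ * B * D⁻¹) := by
  have hDu : IsUnit D.det := isUnit_iff_ne_zero.mpr hD
  have hSd : S.det ≠ 0 := by
    letI := Matrix.invertibleOfIsUnitDet D hDu
    rw [Matrix.det_fromBlocks₂₂, Matrix.invOf_eq_nonsing_inv, ← hS] at hP
    exact right_ne_zero_of_mul hP
  have hSu : IsUnit S.det := isUnit_iff_ne_zero.mpr hSd
  refine ⟨hSd, ?_⟩
  have hA : A = S + B * D⁻¹ * C := by rw [hS]; abel
  refine (Matrix.inv_eq_right_inv hV).symm.trans (Matrix.inv_eq_right_inv ?_)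
  have e1 := Matrix.mul_nonsing_inv S hSu
  have e2 := Matrix.mul_nonsing_inv D hDu
  have e3 : ∀ {t : ℕ} (Y : Matrix (Fin r) (Fin t) ℂ), S * (S⁻¹ * Y) = Y := fun Y => by
    rw [← Matrix.mul_assoc, e1, Matrix.one_mul]
  have e4 : ∀ {t : ℕ} (Y : Matrix (Fin s) (Fin t) ℂ), D * (D⁻¹ * Y) = Y := fun Y => by
    rw [← Matrix.mul_assoc, e2, Matrix.one_mul]
  rw [Matrix.fromBlocks_multiply, ← Matrix.fromBlocks_one, hA]
  congr 1 <;>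
    simp only [Matrix.add_mul, Matrix.mul_add, Matrix.mul_neg, Matrix.mul_assoc, e1, e2, e3, e4] <;>
    abel

theorem fromBlocks_sub_aux {r s : ℕ} (A A' : Matrix (Fin r) (Fin r) ℂ)
    (B B' : Matrix (Fin r) (Fin s) ℂ) (C C' : Matrix (Fin s) (Fin r) ℂ)
    (D D' : Matrix (Fin s) (Fin s) ℂ) :
    fromBlocks A B C D - fromBlocks A' B' C' D'
      = fromBlocks (A - A') (B - B') (C - C') (D - D') := by
  simp only [sub_eq_add_neg, Matrix.fromBlocks_neg, Matrix.fromBlocks_add]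

theorem schur_aux {r s : ℕ} (c : ℂ) (hc : c ≠ 0) (T : Matrix (Fin r) (Fin r) ℂ) (hT : T.det ≠ 0)
    (F : Matrix (Fin s) (Fin r) ℂ) (Y : Matrix (Fin r) (Fin s) ℂ) (W Z : Matrix (Fin s) (Fin s) ℂ)
    (hW : F * Y + W = Z) (hZ : Z.det ≠ 0) (Q : Matrix (Idx r s) (Idx r s) ℂ)
    (hQ : Q = fromBlocks (c • T) Y (-(c • (F * T))) W) :
    Q.det ≠ 0 ∧ ∀ V, Q * V = 1 → V.toBlocks₂₂ = Z⁻¹ := by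
  have hL : (fromBlocks 1 0 F 1 : Matrix (Idx r s) (Idx r s) ℂ) * Q
      = fromBlocks (c • T) Y 0 Z := by
    rw [hQ, Matrix.fromBlocks_multiply]
    simp [hW]
  constructor
  · have := congrArg Matrix.det hL
    rw [Matrix.det_mul, Matrix.det_fromBlocks_zero₁₂, Matrix.det_fromBlocks_zero₂₁] at this
    simp only [Matrix.det_one, one_mul, Matrix.det_smul] at this
    rw [this]
    exact mul_ne_zero (mul_ne_zero (pow_ne_zero _ hc) hT) hZ
  · intro V hV
    have h : fromBlocks (c • T) Y 0 Z * V = fromBlocks 1 0 F 1 := by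
      rw [← hL, Matrix.mul_assoc, hV, Matrix.mul_one]
    rw [← Matrix.fromBlocks_toBlocks V, Matrix.fromBlocks_multiply] at h
    have := (Matrix.fromBlocks_inj.mp h).2.2.2
    rw [Matrix.zero_mul, zero_add] at this
    exact (Matrix.inv_eq_right_inv this).symm

/-- Lemma on `det β_{m+2}`. Assume `β_{m−1} ∈ A`, `β_m ∈ A_𝔎` with
`ord(det β_m) = r`, `det D_{m,0} ≠ 0` and `det Z₁ ≠ 0`, and define the dPI iterates
`β_{m+1}, β_{m+2}`. Then the coefficient of `ε^j` in `det β_{m+2}` vanishes for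
`j < −r`, and the coefficient of `ε^{−r}` equals the determinant of the indicated
block matrix. -/
theorem det_beta_m2_asymptotics (r s m : ℕ) (hr : 0 < r) (hs : 0 < s) (hm : 2 ≤ m)
    (α : Matrix (Idx r s) (Idx r s) ℂ)
    (βprev βm β1 β2 : Matrix (Idx r s) (Idx r s) LS)
    (hprev : memA βprev) (hβm : memAK βm)
    (hdm : βm.det ≠ 0 ∧ βm.det.order = (r : ℤ))
    (hD : (Dblk βm 0).det ≠ 0)
    (hZ1 : (Z1 m βprev βm α).det ≠ 0)
    (h1 : β1 = (m : LS) • βm⁻¹ - βprev - βm - constM α)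
    (h2 : β2 = ((m : LS) + 1) • β1⁻¹ - βm - β1 - constM α) :
    (∀ j : ℤ, j < -(r : ℤ) → β2.det.coeff j = 0) ∧
    β2.det.coeff (-(r : ℤ)) =
      (Matrix.fromBlocks
        (-((m : ℂ) • (S1 βm)⁻¹))
        ((m : ℂ) • ((S1 βm)⁻¹ * Bblk βm 1 * (Dblk βm 0)⁻¹) + Bblk βprev 0)
        ((m : ℂ) • ((Dblk βm 0)⁻¹ * Cblk βm 0 * (S1 βm)⁻¹))
        (((m : ℂ) + 1) • (Z1 m βprev βm α)⁻¹ - (m : ℂ) • (Dblk βm 0)⁻¹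
          - (m : ℂ) • ((Dblk βm 0)⁻¹ * Cblk βm 0 * (S1 βm)⁻¹ * Bblk βm 1 * (Dblk βm 0)⁻¹)
          + Dblk βprev 0)).det := by
  obtain ⟨Bp, hBp, kBp⟩ := lift_memA βprev hprev
  obtain ⟨P, hP, kP⟩ := lift_memAK βm hβm
  have hc : (m : ℂ) ≠ 0 := by
    exact_mod_cast (by omega : m ≠ 0)
  have hdetP : (Kap P).det ≠ 0 := by
    have h0 : βm.det = phi (PowerSeries.X ^ r) * phi P.det := by
      rw [hP, Phi, ← RingHom.map_det, Matrix.det_mul, det_EE, map_mul]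
    have h3 : βm.det.coeff βm.det.order ≠ 0 := HahnSeries.coeff_order_eq_zero.not.mpr hdm.1
    rw [hdm.2, h0, phi_X_pow, HahnSeries.coeff_single_mul, one_mul, sub_self, phi_coeff] at h3
    rw [Kap, ← RingHom.map_det]
    simpa using h3
  obtain ⟨V, hPV, hVP⟩ := exists_inv P hdetP
  have kPV : Kap P * Kap V = 1 := by rw [← map_mul, hPV, map_one]
  rw [kP] at hdetP kPV
  obtain ⟨hS, kV⟩ := block_inv _ _ _ _ (S1 βm) rfl hD hdetP _ kPV
  have hSi : (S1 βm)⁻¹.det ≠ 0 := by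
    rw [Matrix.det_nonsing_inv, Ring.inverse_eq_inv']
    exact inv_ne_zero hS
  set E := EE r s with hE
  have kE : Kap E = fromBlocks 0 0 0 1 := kap_EE r s
  let a : Matrix (Idx r s) (Idx r s) (PowerSeries ℂ) := α.map PowerSeries.C
  have hα : constM α = Phi a := by
    ext i j : 2
    simp [a, constM, phi_C]
  have ka : Kap a = α := by
    ext i j
    simp [a]
  let Q := (m : PowerSeries ℂ) • V - (Bp + E * P + a) * E
  have kQ : Kap Q = fromBlocks ((m : ℂ) • (S1 βm)⁻¹)
      (-((m : ℂ) • ((S1 βm)⁻¹ * Bblk βm 1 * (Dblk βm 0)⁻¹)) - Bblk βprev 0 - α.toBlocks₁₂)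
      (-((m : ℂ) • ((Dblk βm 0)⁻¹ * Cblk βm 0 * (S1 βm)⁻¹)))
      ((m : ℂ) • ((Dblk βm 0)⁻¹
          + ((Dblk βm 0)⁻¹ * Cblk βm 0 * (S1 βm)⁻¹ * Bblk βm 1 * (Dblk βm 0)⁻¹))
          - Dblk βprev 0 - Dblk βm 0 - α.toBlocks₂₂) := by
    have e : Kap Q = (m : ℂ) • Kap V - (Kap Bp + Kap E * Kap P + Kap a) * Kap E := by
      have : Q = (m : Matrix (Idx r s) (Idx r s) (PowerSeries ℂ)) * V
          - (Bp + E * P + a) * E := by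
        simp only [Q]
        rw [Nat.cast_smul_eq_nsmul, nsmul_eq_mul]
      rw [this, map_sub, map_mul, map_mul, map_add, map_add, map_mul, map_natCast,
        Nat.cast_smul_eq_nsmul, nsmul_eq_mul]
    have f1 : coeffM βprev 0 = fromBlocks (Ablk βprev 0) (Bblk βprev 0) (Cblk βprev 0)
      (Dblk βprev 0) := (Matrix.fromBlocks_toBlocks _).symm
    rw [e, kV, kBp, kP, kE, ka, f1]
    nth_rewrite 1 [← Matrix.fromBlocks_toBlocks α]
    simp only [Matrix.fromBlocks_multiply, Matrix.fromBlocks_smul, Matrix.fromBlocks_add,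
      fromBlocks_sub_aux, Matrix.mul_zero, Matrix.zero_mul, Matrix.mul_one, Matrix.one_mul,
      add_zero, zero_add, sub_zero, smul_neg]
    congr 1 <;> abel
  obtain ⟨hdetQ, hQ22⟩ := schur_aux (m : ℂ) hc _ hSi ((Dblk βm 0)⁻¹ * Cblk βm 0) _ _
    (Z1 m βprev βm α) (by
      simp only [Z1, Matrix.mul_sub, Matrix.mul_add, Matrix.mul_neg, Matrix.mul_smul, smul_add,
        Matrix.mul_assoc]
      abel) hZ1 _ kQ
  obtain ⟨U, hQU, hUQ⟩ := exists_inv Q hdetQ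
  have kQU : Kap Q * Kap U = 1 := by rw [← map_mul, hQU, map_one]
  have kU := hQ22 _ kQU
  -- the main identity
  have hEdet : (Phi E).det = HahnSeries.single (r : ℤ) (1 : ℂ) := by
    rw [Phi, ← RingHom.map_det, det_EE, phi_X_pow]
  have hEu : IsUnit (Phi E).det := by
    rw [hEdet]
    exact isUnit_iff_ne_zero.mpr (HahnSeries.single_ne_zero one_ne_zero)
  have hEE : Phi E * (Phi E)⁻¹ = 1 := Matrix.mul_nonsing_inv _ hEu
  have hEE' : (Phi E)⁻¹ * Phi E = 1 := Matrix.nonsing_inv_mul _ hEu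
  have hPV' : Phi P * Phi V = 1 := by rw [← map_mul, hPV, map_one]
  have hQU' : Phi Q * Phi U = 1 := by rw [← map_mul, hQU, map_one]
  have ibm : βm⁻¹ = Phi V * (Phi E)⁻¹ := by
    apply Matrix.inv_eq_right_inv
    rw [hP, map_mul, Matrix.mul_assoc, ← Matrix.mul_assoc (Phi P), hPV', Matrix.one_mul, hEE]
  have smulN : ∀ M : Matrix (Idx r s) (Idx r s) LS, (m : LS) • M = (m : Matrix (Idx r s) (Idx r s) LS) * M := by
    intro M
    rw [← nsmul_eq_mul, ← Nat.cast_smul_eq_nsmul LS]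
  have PhiQ : Phi Q = (m : Matrix (Idx r s) (Idx r s) LS) * Phi V - (βprev + βm + constM α) * Phi E := by
    have : Q = (m : Matrix (Idx r s) (Idx r s) (PowerSeries ℂ)) * V
          - (Bp + E * P + a) * E := by
        simp only [Q]
        rw [Nat.cast_smul_eq_nsmul, nsmul_eq_mul]
    rw [this, hBp, hP, hα, map_sub, map_mul, map_mul, map_add, map_add, map_natCast]
  have hb1 : β1 = Phi Q * (Phi E)⁻¹ := by
    rw [h1, ibm, PhiQ, smulN, Matrix.sub_mul, Matrix.mul_assoc (_ + _ + _), hEE, Matrix.mul_one,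
      Matrix.mul_assoc]
    abel
  have ib1 : β1⁻¹ = Phi E * Phi U := by
    apply Matrix.inv_eq_right_inv
    rw [hb1, Matrix.mul_assoc, ← Matrix.mul_assoc _ (Phi E), hEE', Matrix.one_mul, hQU']
  let T := ((m + 1 : ℕ) : Matrix (Idx r s) (Idx r s) (PowerSeries ℂ)) * (E * U * E)
    - (m : Matrix (Idx r s) (Idx r s) (PowerSeries ℂ)) * V + Bp * E
  have hT : β2 * Phi E = Phi T := by
    have e1 : Phi T = ((m + 1 : ℕ) : Matrix (Idx r s) (Idx r s) LS) * (Phi E * Phi U * Phi E)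
      - (m : Matrix (Idx r s) (Idx r s) LS) * Phi V + βprev * Phi E := by
      simp only [T]
      rw [map_add, map_sub, map_mul, map_mul, map_mul, map_mul, map_mul, map_natCast, map_natCast,
        hBp]
    have e2 : ((m : LS) + 1) • β1⁻¹ = ((m + 1 : ℕ) : Matrix (Idx r s) (Idx r s) LS) * β1⁻¹ := by
      rw [← nsmul_eq_mul, ← Nat.cast_smul_eq_nsmul LS]; push_cast; rfl
    have e3 : β2 = ((m + 1 : ℕ) : Matrix (Idx r s) (Idx r s) LS) * β1⁻¹
        - (m : Matrix (Idx r s) (Idx r s) LS) * βm⁻¹ + βprev := by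
      rw [h2, e2]
      nth_rewrite 2 [h1]
      rw [smulN]
      abel
    rw [e1, e3, ib1, ibm, Matrix.add_mul, Matrix.sub_mul]
    simp only [Matrix.mul_assoc, hEE', Matrix.mul_one]
  have hdetT : β2.det = HahnSeries.single (-(r : ℤ)) (1 : ℂ) * phi T.det := by
    have := congrArg Matrix.det hT
    rw [Matrix.det_mul, hEdet, Phi, ← RingHom.map_det] at this
    rw [← this, mul_comm, mul_assoc, HahnSeries.single_mul_single]
    simp
  have kT : Kap T = fromBlocks (-((m : ℂ) • (S1 βm)⁻¹))
        ((m : ℂ) • ((S1 βm)⁻¹ * Bblk βm 1 * (Dblk βm 0)⁻¹) + Bblk βprev 0)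
        ((m : ℂ) • ((Dblk βm 0)⁻¹ * Cblk βm 0 * (S1 βm)⁻¹))
        (((m : ℂ) + 1) • (Z1 m βprev βm α)⁻¹ - (m : ℂ) • (Dblk βm 0)⁻¹
          - (m : ℂ) • ((Dblk βm 0)⁻¹ * Cblk βm 0 * (S1 βm)⁻¹ * Bblk βm 1 * (Dblk βm 0)⁻¹)
          + Dblk βprev 0) := by
    have e : Kap T = ((m : ℂ) + 1) • (Kap E * Kap U * Kap E) - (m : ℂ) • Kap V
        + Kap Bp * Kap E := by
      have c1 : ((m : ℂ) + 1) = ((m + 1 : ℕ) : ℂ) := by push_cast; rfl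
      simp only [T]
      rw [map_add, map_sub, map_mul, map_mul, map_mul, map_mul, map_mul, map_natCast, map_natCast,
        c1, Nat.cast_smul_eq_nsmul, nsmul_eq_mul, Nat.cast_smul_eq_nsmul, nsmul_eq_mul]
    have f1 : coeffM βprev 0 = fromBlocks (Ablk βprev 0) (Bblk βprev 0) (Cblk βprev 0)
      (Dblk βprev 0) := (Matrix.fromBlocks_toBlocks _).symm
    rw [e, kV, kBp, kE, f1, ← Matrix.fromBlocks_toBlocks (Kap U), kU]
    simp only [Matrix.fromBlocks_multiply, Matrix.fromBlocks_smul, Matrix.fromBlocks_add,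
      fromBlocks_sub_aux, Matrix.mul_zero, Matrix.zero_mul, Matrix.mul_one, Matrix.one_mul,
      add_zero, zero_add, smul_zero, zero_sub, smul_neg, neg_neg, smul_add]
    congr 1
    abel
  constructor
  · intro j hj
    rw [hdetT, HahnSeries.coeff_single_mul, phi_coeff, if_pos (by omega), mul_zero]
  · rw [hdetT, HahnSeries.coeff_single_mul, one_mul, sub_self, phi_coeff, ← kT, Kap,
      ← RingHom.map_det]
    simp
end
end
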